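/- Let i be a nonnegative integer, x a complex number, and α a complex number such that 2α−i is not a nonpositive integer and α+m−i+1/2 is not a nonpositive integer for 0 ≤ m ≤ i, and (α−i−1/2)_m ≠ 0 for 0 ≤ m ≤ i. Then e^{−x/2} · ₁F₁(α; 2α−i; x) = Σ_{m=0}^{i} [(−1)^m (−i)_m (2α−2i−1)_m] / [(2α−i)_m (α−i−1/2)_m m! 2^{2m}] · x^m · ₀F₁(—; α+m−i+1/2; x²/16). -/

import Mathlib

/-- Pochhammer symbol (rising factorial) `(c)_k = c (c+1) ⋯ (c+k-1)` for complex `c`. -/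
noncomputable def poch (c : ℂ) (k : ℕ) : ℂ := ∏ l ∈ Finset.range k, (c + l)

/-- Generalized hypergeometric series `ₚF_q(a; b; x) = Σ_k (a₁)_k⋯(a_p)_k / ((b₁)_k⋯(b_q)_k) · x^k/k!`. -/
noncomputable def pFq (a b : List ℂ) (x : ℂ) : ℂ :=
  ∑' k : ℕ, ((a.map (fun c => poch c k)).prod / (b.map (fun c => poch c k)).prod)
    * x ^ k / (Nat.factorial k)

/-- `c` is not a nonpositive integer, i.e. `c ≠ 0, -1, -2, …`. -/
def NotNonposInt (c : ℂ) : Prop := ∀ n : ℕ, c ≠ -(n : ℂ)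
open PowerSeries Finset Filter Topology

theorem poch_zero (c : ℂ) : poch c 0 = 1 := by simp [poch]

theorem poch_succ (c : ℂ) (k : ℕ) : poch c (k + 1) = poch c k * (c + k) := by
  simp [poch, Finset.prod_range_succ]

theorem poch_succ' (c : ℂ) (k : ℕ) : poch c (k + 1) = c * poch (c + 1) k := by
  simp [poch, Finset.prod_range_succ', mul_comm, add_comm, add_left_comm]

theorem NotNonposInt.add_natCast_ne_zero {c : ℂ} (h : NotNonposInt c) (n : ℕ) : c + n ≠ 0 :=
  fun h' => h n (eq_neg_of_add_eq_zero_left h')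

theorem NotNonposInt.ne_zero {c : ℂ} (h : NotNonposInt c) : c ≠ 0 := by
  simpa using h 0

theorem NotNonposInt.add_one {c : ℂ} (h : NotNonposInt c) : NotNonposInt (c + 1) := fun n hn =>
  h (n + 1) (by push_cast; linear_combination hn)

theorem NotNonposInt.poch_ne_zero {c : ℂ} (h : NotNonposInt c) (k : ℕ) : poch c k ≠ 0 :=
  Finset.prod_ne_zero_iff.2 fun n _ => h.add_natCast_ne_zero n

/-- The differential operator `f ↦ X * (X * D (D f) + b * D f - s * f - (X / 4) * f)` on formal
power series. -/
noncomputable def kummerOp (b s : ℂ) (f : ℂ⟦X⟧) : ℂ⟦X⟧ :=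
  X * (X * d⁄dX ℂ (d⁄dX ℂ f) + C b * d⁄dX ℂ f - C s * f - C (1 / 4) * (X * f))

theorem kummerOp_sub (b s : ℂ) (f g : ℂ⟦X⟧) :
    kummerOp b s (f - g) = kummerOp b s f - kummerOp b s g := by
  simp only [kummerOp, map_sub]; ring

theorem kummerOp_C_mul (b s c : ℂ) (f : ℂ⟦X⟧) :
    kummerOp b s (C c * f) = C c * kummerOp b s f := by
  simp only [kummerOp, Derivation.leibniz, derivative_C, smul_eq_mul, mul_zero, add_zero]; ring

theorem kummerOp_sum (b s : ℂ) (f : ℕ → ℂ⟦X⟧) (n : ℕ) :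
    kummerOp b s (∑ m ∈ range n, f m) = ∑ m ∈ range n, kummerOp b s (f m) := by
  simp only [kummerOp, map_sum, Finset.mul_sum, ← Finset.sum_add_distrib,
    ← Finset.sum_sub_distrib]

theorem eq_zero_of_kummerOp_eq_zero {b s : ℂ} (hb : NotNonposInt b) {f : ℂ⟦X⟧}
    (hf : kummerOp b s f = 0) (h0 : coeff 0 f = 0) : f = 0 := by
  have h : X * d⁄dX ℂ (d⁄dX ℂ f) + C b * d⁄dX ℂ f - C s * f - C (1 / 4) * (X * f) = 0 :=
    (mul_eq_zero.1 hf).resolve_left X_ne_zero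
  ext n
  induction n using Nat.strong_induction_on with
  | _ n ih =>
    rcases n with _ | n
    · simpa using h0
    have hn := congrArg (coeff n) h
    have h1 := hb.add_natCast_ne_zero n
    have h2 : (n : ℂ) + 1 ≠ 0 := by exact_mod_cast n.succ_ne_zero
    have key : (b + n) * (n + 1) * coeff (n + 1) f = 0 := by
      rcases n with _ | n
      · simp only [map_sub, map_add, coeff_C_mul, coeff_zero_X_mul, coeff_derivative, h0,
          map_zero] at hn
        push_cast at hn ⊢
        linear_combination hn
      · simp only [map_sub, map_add, coeff_C_mul, coeff_succ_X_mul, coeff_derivative,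
          ih n (by omega), ih (n + 1) (by omega), map_zero] at hn
        push_cast at hn ⊢
        linear_combination hn
    simpa [h1, h2] using key

/-- The formal power series of `₀F₁(—; c; x² / 16)`. -/
noncomputable def besselSeries (c : ℂ) : ℂ⟦X⟧ :=
  mk fun n => if Even n then (poch c (n / 2) * (n / 2).factorial * 16 ^ (n / 2))⁻¹ else 0

theorem coeff_besselSeries_two_mul (c : ℂ) (j : ℕ) :
    coeff (2 * j) (besselSeries c) = (poch c j * j.factorial * 16 ^ j)⁻¹ := by
  simp [besselSeries]

theorem coeff_besselSeries_two_mul_add_one (c : ℂ) (j : ℕ) :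
    coeff (2 * j + 1) (besselSeries c) = 0 := by
  simp [besselSeries]

theorem derivative_besselSeries {c : ℂ} (hc : NotNonposInt c) :
    d⁄dX ℂ (besselSeries c) = C (1 / (8 * c)) * (X * besselSeries (c + 1)) := by
  ext n
  rcases n.even_or_odd' with ⟨j, rfl | rfl⟩
  · rw [coeff_derivative, coeff_besselSeries_two_mul_add_one, coeff_C_mul]
    rcases j with _ | j
    · simp
    · rw [show 2 * (j + 1) = 2 * j + 1 + 1 by ring, coeff_succ_X_mul,
        coeff_besselSeries_two_mul_add_one]
      simp
  · rw [coeff_derivative, show 2 * j + 1 + 1 = 2 * (j + 1) by ring, coeff_C_mul,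
      coeff_succ_X_mul, coeff_besselSeries_two_mul, coeff_besselSeries_two_mul, poch_succ',
      Nat.factorial_succ]
    have h1 := hc.ne_zero
    have h2 := hc.add_one.poch_ne_zero j
    have h3 : (j : ℂ) + 1 ≠ 0 := by exact_mod_cast j.succ_ne_zero
    have h4 : (j.factorial : ℂ) ≠ 0 := by exact_mod_cast j.factorial_ne_zero
    push_cast
    field_simp
    ring

theorem besselSeries_sub {c : ℂ} (hc : NotNonposInt c) :
    besselSeries c - besselSeries (c + 1) =
      C (1 / (16 * c * (c + 1))) * (X * (X * besselSeries (c + 2))) := by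
  ext n
  rcases n.even_or_odd' with ⟨j, rfl | rfl⟩
  · rw [map_sub, coeff_C_mul]
    rcases j with _ | j
    · simp [besselSeries, poch_zero]
    · rw [coeff_besselSeries_two_mul, coeff_besselSeries_two_mul,
        show 2 * (j + 1) = 2 * j + 1 + 1 by ring, coeff_succ_X_mul, coeff_succ_X_mul,
        coeff_besselSeries_two_mul, poch_succ', poch_succ, Nat.factorial_succ]
      have h1 := hc.ne_zero
      have h2 := hc.add_one.ne_zero
      have h3 : (j : ℂ) + 1 ≠ 0 := by exact_mod_cast j.succ_ne_zero
      have h4 : (j.factorial : ℂ) ≠ 0 := by exact_mod_cast j.factorial_ne_zero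
      have h5 := hc.add_one.add_one.poch_ne_zero j
      have h6 := hc.add_one.add_natCast_ne_zero j
      have h7 : poch (c + 1) j * (c + 1 + j) = (c + 1) * poch (c + 2) j := by
        rw [← poch_succ, poch_succ', add_assoc, one_add_one_eq_two]
      rw [show c + 1 + 1 = c + 2 by ring] at h5
      have h8 : poch (c + 1) j = (c + 1) * poch (c + 2) j / (c + 1 + j) := by
        rw [← h7]; field_simp
      rw [h8]
      push_cast
      field_simp
      ring
  · rw [map_sub, coeff_besselSeries_two_mul_add_one, coeff_besselSeries_two_mul_add_one,
      coeff_C_mul, coeff_succ_X_mul]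
    rcases j with _ | j
    · simp
    · rw [show 2 * (j + 1) = 2 * j + 1 + 1 by ring, coeff_succ_X_mul,
        coeff_besselSeries_two_mul_add_one]
      simp

theorem derivative_derivative_besselSeries {c : ℂ} (hc : NotNonposInt c) :
    X * d⁄dX ℂ (d⁄dX ℂ (besselSeries c)) =
      C (1 / 4) * (X * besselSeries c) - C (2 * c - 1) * d⁄dX ℂ (besselSeries c) := by
  have h1 := hc.ne_zero
  have h2 := hc.add_one.ne_zero
  have e := besselSeries_sub hc
  rw [derivative_besselSeries hc]
  simp only [Derivation.leibniz, derivative_C, derivative_X, smul_eq_mul, mul_zero, add_zero,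
    mul_one]
  rw [derivative_besselSeries hc.add_one, show c + 1 + 1 = c + 2 by ring]
  have e1 : (C (1 / (8 * c)) * C (1 / (8 * (c + 1))) : ℂ⟦X⟧) =
      C (1 / 4) * C (1 / (16 * c * (c + 1))) := by
    rw [← map_mul, ← map_mul]; congr 1; field_simp; norm_num
  have e2 : (C (1 / (8 * c)) * C (2 * c - 1) : ℂ⟦X⟧) = C (1 / 4) - C (1 / (8 * c)) := by
    rw [← map_mul, ← map_sub]; congr 1; field_simp; ring
  linear_combination (X ^ 3 * besselSeries (c + 2)) * e1 + (X * besselSeries (c + 1)) * e2 -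
    C (1 / 4) * X * e

theorem kummerOp_X_pow_mul_besselSeries {i ν : ℂ} {m : ℕ} (hc : NotNonposInt (ν + m + 1)) :
    kummerOp (2 * ν + 1 + i) (i / 2) (X ^ m * besselSeries (ν + m + 1)) =
      X ^ m * (C (m * (m + 2 * ν + i)) * besselSeries (ν + m + 1) +
        C i * (X * d⁄dX ℂ (besselSeries (ν + m + 1))) -
        C (i / 2) * (X * besselSeries (ν + m + 1))) := by
  have h := derivative_derivative_besselSeries hc
  have e1 : X * d⁄dX ℂ (X ^ m : ℂ⟦X⟧) = C (m : ℂ) * X ^ m := by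
    rcases m with _ | m
    · simp
    · rw [derivative_pow, derivative_X, Nat.add_sub_cancel, map_natCast]; ring
  have e2 : X * (X * d⁄dX ℂ (d⁄dX ℂ (X ^ m : ℂ⟦X⟧))) = C ((m : ℂ) * (m - 1)) * X ^ m := by
    have := congrArg (d⁄dX ℂ) e1
    simp only [Derivation.leibniz, derivative_C, derivative_X, smul_eq_mul, mul_zero, add_zero,
      mul_one] at this
    simp only [map_mul, map_sub, map_one]
    linear_combination X * this + (C (m : ℂ) - 1) * e1
  have e3 : (C 2 : ℂ⟦X⟧) = 2 := map_ofNat C 2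
  unfold kummerOp
  simp only [Derivation.leibniz, map_add, smul_eq_mul]
  simp only [map_mul, map_add, map_sub, map_one, e3] at h e2 ⊢
  generalize besselSeries (ν + m + 1) = g at *
  generalize (d⁄dX ℂ) ((d⁄dX ℂ) g) = g2 at *
  generalize (d⁄dX ℂ) g = g1 at *
  generalize (d⁄dX ℂ) ((d⁄dX ℂ) (X ^ m : ℂ⟦X⟧)) = p2 at *
  generalize (d⁄dX ℂ) (X ^ m : ℂ⟦X⟧) = p1 at *
  linear_combination g * e2 + (2 * X * g1 + (2 * C ν + 1 + C i) * g) * e1 + X * X ^ m * h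

/-- The coefficient of `x ^ m * ₀F₁(—; ν + m + 1; x² / 16)` in the expansion of
`exp (-x / 2) * ₁F₁(ν + i + 1 / 2; 2 * ν + 1 + i; x)`. -/
noncomputable def kummerCoeff (i : ℕ) (ν : ℂ) (m : ℕ) : ℂ :=
  ((-1) ^ m * poch (-(i : ℂ)) m * poch (2 * ν) m) /
    (poch (2 * ν + 1 + i) m * poch ν m * m.factorial * 2 ^ (2 * m))

theorem kummerCoeff_zero (i : ℕ) (ν : ℂ) : kummerCoeff i ν 0 = 1 := by
  simp [kummerCoeff, poch_zero]

theorem kummerCoeff_succ (i : ℕ) (ν : ℂ) (m : ℕ) :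
    kummerCoeff i ν (m + 1) = kummerCoeff i ν m * (i - m) * (2 * ν + m) / (ν + m) /
      (4 * (2 * ν + 1 + i + m) * (m + 1)) := by
  simp only [kummerCoeff, poch_succ, Nat.factorial_succ, div_mul_eq_mul_div, div_div]
  push_cast
  congr 1 <;> ring

theorem sum_kummerOp_kummerCoeff {i : ℕ} {ν : ℂ} (hb : NotNonposInt (2 * ν + 1 + i))
    (hν : NotNonposInt (ν + 1)) (h0 : i = 0 ∨ ν ≠ 0) (M : ℕ) :
    ∑ m ∈ range (M + 1), C (kummerCoeff i ν m) *
        kummerOp (2 * ν + 1 + i) (i / 2) (X ^ m * besselSeries (ν + m + 1)) =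
      X ^ (M + 1) *
        (C (kummerCoeff i ν M * (i - M) * (2 * ν + M) / (ν + M) / (16 * (ν + M + 1))) *
            (X * besselSeries (ν + M + 2)) -
          C (kummerCoeff i ν M * (i - M) * (2 * ν + M) / (ν + M) / 4) *
            besselSeries (ν + M + 1)) := by
  induction M with
  | zero =>
    have h1 := hν.ne_zero
    rw [sum_range_one, kummerOp_X_pow_mul_besselSeries (by simpa using hν), kummerCoeff_zero,
      derivative_besselSeries (by simpa using hν)]
    have e : (1 : ℂ) * (i - (0 : ℕ)) * (2 * ν + (0 : ℕ)) / (ν + (0 : ℕ)) = 2 * i := by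
      rcases h0 with rfl | h0
      · simp
      · simp only [Nat.cast_zero, sub_zero, add_zero]; field_simp
    rw [e, show ν + (0 : ℕ) + 1 + 1 = ν + (0 : ℕ) + 2 by ring]
    have e1 : (C (i : ℂ) * C (1 / (8 * (ν + (0 : ℕ) + 1))) : ℂ⟦X⟧) =
        C (2 * i / (16 * (ν + (0 : ℕ) + 1))) := by
      rw [← map_mul]; congr 1; push_cast; rw [add_zero]; field_simp; ring
    have e2 : (C (2 * (i : ℂ) / 4) : ℂ⟦X⟧) = C ((i : ℂ) / 2) := by congr 1; ring
    rw [e2, ← e1]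
    simp only [Nat.cast_zero, zero_mul, map_zero, map_one]
    ring
  | succ M ih =>
    have hμ : NotNonposInt (ν + M + 1) := fun n hn =>
      hν (M + n) (by push_cast; linear_combination hn)
    rw [sum_range_succ, ih]
    have eμ : ν + ((M + 1 : ℕ) : ℂ) = ν + M + 1 := by push_cast; ring
    have h1 := hμ.ne_zero
    have h2 := hμ.add_one.ne_zero
    have h3 := hb.add_natCast_ne_zero M
    have h4 : (M : ℂ) + 1 ≠ 0 := by exact_mod_cast M.succ_ne_zero
    have hs := besselSeries_sub hμ
    have hk := kummerCoeff_succ i ν M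
    rw [kummerOp_X_pow_mul_besselSeries (by rw [eμ]; exact hμ.add_one), eμ,
      derivative_besselSeries hμ.add_one]
    generalize kummerCoeff i ν M * (i - M) * (2 * ν + M) / (ν + M) = t at *
    generalize kummerCoeff i ν (M + 1) = k at *
    obtain rfl : t = k * (4 * (2 * ν + 1 + i + M) * (M + 1)) := by rw [hk]; field_simp
    rw [show ν + M + 1 + 1 + 1 = ν + M + 1 + 2 by ring,
      show ν + M + 2 = ν + M + 1 + 1 by ring]
    generalize hμ' : ν + M + 1 = μ at *
    obtain rfl : ν = μ - M - 1 := by linear_combination hμ'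
    generalize besselSeries (μ + 2) = g2 at *
    generalize besselSeries (μ + 1) = g1 at *
    generalize besselSeries μ = g at *
    push_cast
    have E1 : (C (k * (4 * (2 * (μ - M - 1) + 1 + i + M) * (M + 1)) / 4) : ℂ⟦X⟧) =
        C k * C ((M + 1) * (M + 1 + 2 * (μ - M - 1) + i)) := by
      rw [← map_mul]; congr 1; ring
    have E2 : (C (k * (4 * (2 * (μ - M - 1) + 1 + i + M) * (M + 1)) / (16 * μ)) : ℂ⟦X⟧) -
        C k * C ((i : ℂ) / 2) +
        C (k * (i - (M + 1)) * (2 * (μ - M - 1) + (M + 1)) / μ / 4) = 0 := by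
      rw [← map_mul, ← map_sub, ← map_add, ← map_zero C]; congr 1; field_simp; ring
    have E3 : (C (k * (4 * (2 * (μ - M - 1) + 1 + i + M) * (M + 1)) / 4) : ℂ⟦X⟧) *
          C (1 / (16 * μ * (μ + 1))) -
        C k * C (i : ℂ) * C (1 / (8 * (μ + 1))) +
        C (k * (i - (M + 1)) * (2 * (μ - M - 1) + (M + 1)) / μ / (16 * (μ + 1))) = 0 := by
      rw [← map_mul, ← map_mul, ← map_mul, ← map_sub, ← map_add, ← map_zero C]
      congr 1; field_simp; ring
    linear_combination (-X ^ (M + 1) *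
      C (k * (4 * (2 * (μ - M - 1) + 1 + i + M) * (M + 1)) / 4)) * hs -
      X ^ (M + 1) * g1 * E1 + X ^ (M + 2) * g1 * E2 - X ^ (M + 3) * g2 * E3

theorem kummerOp_sum_kummerCoeff {i : ℕ} {ν : ℂ} (hb : NotNonposInt (2 * ν + 1 + i))
    (hν : NotNonposInt (ν + 1)) (h0 : i = 0 ∨ ν ≠ 0) :
    kummerOp (2 * ν + 1 + i) (i / 2) (∑ m ∈ range (i + 1),
      C (kummerCoeff i ν m) * (X ^ m * besselSeries (ν + m + 1))) = 0 := by
  simp only [kummerOp_sum, kummerOp_C_mul, sum_kummerOp_kummerCoeff hb hν h0]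
  simp

/-- The formal power series of `exp (c * x)`. -/
noncomputable def expSeries (c : ℂ) : ℂ⟦X⟧ := mk fun n => c ^ n / n.factorial

theorem derivative_expSeries (c : ℂ) : d⁄dX ℂ (expSeries c) = C c * expSeries c := by
  ext n
  have h3 : (n : ℂ) + 1 ≠ 0 := by exact_mod_cast n.succ_ne_zero
  have h4 : (n.factorial : ℂ) ≠ 0 := by exact_mod_cast n.factorial_ne_zero
  simp only [expSeries, coeff_derivative, coeff_mk, coeff_C_mul, Nat.factorial_succ]
  push_cast
  field_simp
  ring

/-- The formal power series of `₁F₁(a; b; x)`. -/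
noncomputable def kummerSeries (a b : ℂ) : ℂ⟦X⟧ :=
  mk fun n => poch a n / poch b n / n.factorial

theorem kummerSeries_ode (a : ℂ) {b : ℂ} (hb : NotNonposInt b) :
    X * d⁄dX ℂ (d⁄dX ℂ (kummerSeries a b)) + C b * d⁄dX ℂ (kummerSeries a b) -
      X * d⁄dX ℂ (kummerSeries a b) - C a * kummerSeries a b = 0 := by
  have hs (n : ℕ) : coeff (n + 1) (kummerSeries a b) * ((b + n) * (n + 1)) =
      (a + n) * coeff n (kummerSeries a b) := by
    have h1 := hb.add_natCast_ne_zero n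
    have h2 := hb.poch_ne_zero n
    have h3 : (n : ℂ) + 1 ≠ 0 := by exact_mod_cast n.succ_ne_zero
    have h4 : (n.factorial : ℂ) ≠ 0 := by exact_mod_cast n.factorial_ne_zero
    simp only [kummerSeries, coeff_mk, poch_succ, Nat.factorial_succ]
    push_cast
    field_simp
  ext n
  have h := hs n
  rcases n with _ | n
  · simp only [map_sub, map_add, coeff_C_mul, coeff_zero_X_mul, coeff_derivative, map_zero]
    push_cast at h ⊢
    linear_combination h
  · simp only [map_sub, map_add, coeff_C_mul, coeff_succ_X_mul, coeff_derivative, map_zero]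
    push_cast at h ⊢
    linear_combination h

theorem kummerOp_expSeries_mul_kummerSeries {a b s : ℂ} (hb : NotNonposInt b)
    (hs : s = a - b / 2) :
    kummerOp b s (expSeries (-1 / 2) * kummerSeries a b) = 0 := by
  have h := kummerSeries_ode a hb
  have e1 : (C (-1 / 2) : ℂ⟦X⟧) * 2 = -1 := by
    rw [← map_ofNat C 2, ← map_mul, ← map_one C, ← map_neg]; norm_num
  have e2 : (C (1 / 4) : ℂ⟦X⟧) = C (-1 / 2) * C (-1 / 2) := by
    rw [← map_mul]; norm_num
  have e3 : (C s : ℂ⟦X⟧) = C a + C (-1 / 2) * C b := by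
    rw [← map_mul, ← map_add, hs]; congr 1; ring
  unfold kummerOp
  simp only [Derivation.leibniz, derivative_expSeries, map_add, smul_eq_mul, derivative_C, e2, e3]
  linear_combination X * expSeries (-1 / 2) * h +
    X * X * expSeries (-1 / 2) * d⁄dX ℂ (kummerSeries a b) * e1

theorem expSeries_mul_kummerSeries {i : ℕ} {ν : ℂ} (hb : NotNonposInt (2 * ν + 1 + i))
    (hν : NotNonposInt (ν + 1)) (h0 : i = 0 ∨ ν ≠ 0) :
    expSeries (-1 / 2) * kummerSeries (ν + i + 1 / 2) (2 * ν + 1 + i) =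
      ∑ m ∈ range (i + 1), C (kummerCoeff i ν m) * (X ^ m * besselSeries (ν + m + 1)) := by
  refine sub_eq_zero.1 (eq_zero_of_kummerOp_eq_zero (s := i / 2) hb ?_ ?_)
  · rw [kummerOp_sub, kummerOp_sum_kummerCoeff hb hν h0,
      kummerOp_expSeries_mul_kummerSeries hb (by ring), sub_zero]
  · rw [sum_range_succ']
    simp [expSeries, kummerSeries, besselSeries, poch_zero, kummerCoeff_zero]

theorem summable_norm_of_succ_eq_mul {f ρ : ℕ → ℂ} (h : ∀ n, f (n + 1) = ρ n * f n)
    (hρ : Tendsto ρ atTop (𝓝 0)) : Summable fun n => ‖f n‖ := by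
  refine summable_of_ratio_norm_eventually_le (r := 1 / 2) (by norm_num) ?_
  have : ∀ᶠ n in atTop, ‖ρ n‖ < 1 / 2 := by
    have := hρ.norm
    rw [norm_zero] at this
    exact this.eventually_lt_const (by norm_num)
  filter_upwards [this] with n hn
  rw [norm_norm, norm_norm, h, norm_mul]
  gcongr

theorem tendsto_inv_add_natCast (b : ℂ) :
    Tendsto (fun n : ℕ => (b + n)⁻¹) atTop (𝓝 0) := by
  refine tendsto_inv₀_cobounded.comp ?_
  exact (tendsto_const_add_cobounded b).comp tendsto_natCast_atTop_cobounded

theorem summable_norm_kummerSeries (a x : ℂ) {b : ℂ} (hb : NotNonposInt b) :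
    Summable fun n => ‖coeff n (kummerSeries a b) * x ^ n‖ := by
  refine summable_norm_of_succ_eq_mul
    (ρ := fun n => x * (((a - b) * (b + n)⁻¹ + 1) * (1 + (n : ℂ))⁻¹)) (fun n => ?_) ?_
  · have h1 := hb.add_natCast_ne_zero n
    have h2 := hb.poch_ne_zero n
    have h3 : 1 + (n : ℂ) ≠ 0 := by rw [add_comm]; exact_mod_cast n.succ_ne_zero
    have h4 : (n.factorial : ℂ) ≠ 0 := by exact_mod_cast n.factorial_ne_zero
    simp only [kummerSeries, coeff_mk, poch_succ, Nat.factorial_succ]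
    push_cast
    rw [add_comm (n : ℂ) 1]
    field_simp
    ring
  · simpa using ((((tendsto_inv_add_natCast b).const_mul (a - b)).add_const 1).mul
      (tendsto_inv_add_natCast 1)).const_mul x

theorem summable_norm_expSeries (c x : ℂ) :
    Summable fun n => ‖coeff n (expSeries c) * x ^ n‖ := by
  simpa [expSeries, mul_pow, div_mul_eq_mul_div] using
    NormedSpace.norm_expSeries_div_summable (c * x)

theorem tsum_expSeries (c x : ℂ) :
    ∑' n, coeff n (expSeries c) * x ^ n = Complex.exp (c * x) := by
  rw [Complex.exp_eq_exp_ℂ, NormedSpace.exp_eq_tsum_div]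
  simp [expSeries, mul_pow, div_mul_eq_mul_div]

theorem tsum_expSeries_mul_kummerSeries (a x : ℂ) {b : ℂ} (hb : NotNonposInt b) :
    ∑' n, coeff n (expSeries (-1 / 2) * kummerSeries a b) * x ^ n =
      Complex.exp (-x / 2) * pFq [a] [b] x := by
  have h : pFq [a] [b] x = ∑' n, coeff n (kummerSeries a b) * x ^ n := by
    simp only [pFq, kummerSeries, coeff_mk, List.map_cons, List.map_nil, List.prod_cons,
      List.prod_nil, mul_one]
    exact tsum_congr fun n => by ring
  rw [h, show -x / 2 = -1 / 2 * x by ring, ← tsum_expSeries,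
    tsum_mul_tsum_eq_tsum_sum_antidiagonal_of_summable_norm (summable_norm_expSeries _ x)
      (summable_norm_kummerSeries a x hb)]
  refine tsum_congr fun n => ?_
  rw [coeff_mul, Finset.sum_mul]
  refine Finset.sum_congr rfl fun p hp => ?_
  rw [← mem_antidiagonal.1 hp, pow_add]
  ring

theorem hasSum_X_pow_mul_besselSeries (m : ℕ) (x : ℂ) {c : ℂ} (hc : NotNonposInt c) :
    HasSum (fun n => coeff n (X ^ m * besselSeries c) * x ^ n)
      (x ^ m * pFq [] [c] (x ^ 2 / 16)) := by
  have hinj : Function.Injective fun j : ℕ => 2 * j + m := fun j k h => by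
    simpa using h
  rw [← hinj.hasSum_iff]
  · have hsum : Summable fun j : ℕ => ((([] : List ℂ).map fun c => poch c j).prod /
        (([c] : List ℂ).map fun c => poch c j).prod) * (x ^ 2 / 16) ^ j / j.factorial := by
      refine Summable.of_norm (summable_norm_of_succ_eq_mul
        (ρ := fun j => x ^ 2 / 16 * ((c + j)⁻¹ * (1 + (j : ℂ))⁻¹)) (fun j => ?_) ?_)
      · simp only [List.map_cons, List.map_nil, List.prod_cons, List.prod_nil, mul_one,
          poch_succ, Nat.factorial_succ]
        have h1 := hc.add_natCast_ne_zero j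
        have h2 := hc.poch_ne_zero j
        have h3 : 1 + (j : ℂ) ≠ 0 := by rw [add_comm]; exact_mod_cast j.succ_ne_zero
        have h4 : (j.factorial : ℂ) ≠ 0 := by exact_mod_cast j.factorial_ne_zero
        push_cast
        rw [add_comm (j : ℂ) 1, pow_succ]
        field_simp
      · simpa using ((tendsto_inv_add_natCast c).mul
          (tendsto_inv_add_natCast 1)).const_mul (x ^ 2 / 16)
    convert! hsum.hasSum.mul_left (x ^ m) using 1
    ext j
    have h2 := hc.poch_ne_zero j
    have h4 : (j.factorial : ℂ) ≠ 0 := by exact_mod_cast j.factorial_ne_zero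
    simp only [Function.comp_apply, coeff_X_pow_mul, coeff_besselSeries_two_mul, List.map_cons,
      List.map_nil, List.prod_cons, List.prod_nil, mul_one]
    rw [div_pow]
    field_simp
    ring
  · intro n hn
    rw [coeff_X_pow_mul']
    split_ifs with hmn
    · obtain ⟨k, rfl⟩ := Nat.exists_eq_add_of_le' hmn
      rcases k.even_or_odd' with ⟨j, rfl | rfl⟩
      · exact absurd ⟨j, rfl⟩ hn
      · rw [Nat.add_sub_cancel, coeff_besselSeries_two_mul_add_one, zero_mul]
    · rw [zero_mul]

theorem kummer_generalization_minus (i : ℕ) (x α : ℂ)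
    (h1 : NotNonposInt (2*α - i))
    (h2 : ∀ m : ℕ, m ≤ i → NotNonposInt (α + m - i + 1/2))
    (h3 : ∀ m : ℕ, m ≤ i → poch (α - i - 1/2) m ≠ 0) :
    Complex.exp (-x/2) * pFq [α] [2*α - i] x =
      ∑ m ∈ Finset.range (i+1),
        ((-1) ^ m * poch (-(i:ℂ)) m * poch (2*α - 2*i - 1) m) /
          (poch (2*α - i) m * poch (α - i - 1/2) m * (Nat.factorial m) * 2 ^ (2*m)) *
        x ^ m * pFq [] [α+m-i+1/2] (x^2/16) := by
  obtain ⟨ν, rfl⟩ : ∃ ν, α = ν + i + 1 / 2 := ⟨α - i - 1 / 2, by ring⟩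
  have e1 : 2 * (ν + i + 1 / 2) - i = 2 * ν + 1 + i := by ring
  have e2 : ν + i + 1 / 2 - i - 1 / 2 = ν := by ring
  have e3 : 2 * (ν + i + 1 / 2) - 2 * i - 1 = 2 * ν := by ring
  have e4 (m : ℕ) : ν + i + 1 / 2 + m - i + 1 / 2 = ν + m + 1 := by ring
  simp only [e1, e2, e3, e4] at h1 h2 h3 ⊢
  have hν : NotNonposInt (ν + 1) := by simpa using h2 0 (Nat.zero_le i)
  have h0 : i = 0 ∨ ν ≠ 0 := by
    rcases Nat.eq_zero_or_pos i with h | h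
    · exact Or.inl h
    · exact Or.inr (by simpa [poch] using h3 1 h)
  rw [← tsum_expSeries_mul_kummerSeries _ x h1, expSeries_mul_kummerSeries h1 hν h0]
  have hsum := hasSum_sum (s := range (i + 1)) fun m hm =>
    (hasSum_X_pow_mul_besselSeries m x
      (h2 m (Nat.lt_succ_iff.1 (mem_range.1 hm)))).mul_left (kummerCoeff i ν m)
  refine Eq.trans (tsum_congr fun n => ?_) (hsum.tsum_eq.trans ?_)
  · simp only [map_sum, coeff_C_mul, Finset.sum_mul, mul_assoc]
  · exact Finset.sum_congr rfl fun m _ => by rw [kummerCoeff]; ring
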